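/- Let K ≥ 1 with K ≡ 0 (mod 3). Then every (2K+2)-th root of unity ζ with ζ ≠ −1, and additionally with ζ ∉ {i, −i} in case K is odd, is an eigenvalue of the complex transfer matrix 𝕆_K. -/

import Mathlib

/-- The Fibonacci numbers with the convention `F 0 = F 1 = 1`. -/
def F (n : ℕ) : ℕ := Nat.fib (n + 1)

/-- The index set of the transfer matrix: subsets of `{1,…,K}` containing no two
consecutive integers (independent sets of a path with `K` vertices), encoded as
subsets `C` of `Fin K`, where `k : Fin K` represents the integer `k + 1`. -/
abbrev PathIndep (K : ℕ) :=
  {C : Finset (Fin K) // ∀ c ∈ C, ∀ d ∈ C, (c : ℕ) ≠ (d : ℕ) + 1}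

/-- The transfer matrix `𝕆_K`, of size `F_{K+1}`, with rows and columns indexed by the
subsets of `{1,…,K}` with no two consecutive elements: the entry in row `C` and column
`D` is `i^(|C|+|D|)` if `C ∩ D = ∅`, and `0` otherwise. -/
def Omat (K : ℕ) : Matrix (PathIndep K) (PathIndep K) ℂ :=
  fun C D => if C.1 ∩ D.1 = ∅ then Complex.I ^ (C.1.card + D.1.card) else 0

/-- `μ` is an eigenvalue of the square complex matrix `A`: there is a nonzero
vector `v` with `A v = μ v`. -/
def IsEigenvalue {n : Type*} [Fintype n] (A : Matrix n n ℂ) (μ : ℂ) : Prop :=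
  ∃ v : n → ℂ, v ≠ 0 ∧ A.mulVec v = μ • v

namespace OmatAux

open Finset

/-- Eight local functions on a block of three consecutive cells. -/
def L (k : Fin 8) (s : Finset (Fin 3)) : ℤ :=
  match k with
  | 0 => if s = {2} then 1 else 0
  | 1 => if s = ∅ ∨ s = {0} ∨ s = {1} then -1 else 0
  | 2 => if s = ∅ ∨ s = {2} then 1 else 0
  | 3 => if s = {2} ∨ s = {0, 2} then 1 else 0
  | 4 => if s = {0} then -1 else 0
  | 5 => if s = ∅ ∨ s = {1} ∨ s = {2} then 1 else 0
  | 6 => if s = ∅ ∨ s = {0} then -1 else 0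
  | 7 => if s = {0} ∨ s = {0, 2} then -1 else 0

/-- Local independence. -/
def Loc (s : Finset (Fin 3)) : Prop := ¬ (0 ∈ s ∧ 1 ∈ s) ∧ ¬ (1 ∈ s ∧ 2 ∈ s)

instance (s : Finset (Fin 3)) : Decidable (Loc s) := by unfold Loc; infer_instance

/-- Adjacent local functions do not charge adjacent cells. -/
def Compat (x y : Fin 8) : Prop :=
  ∀ s t, L x s ≠ 0 → L y t ≠ 0 → ¬ ((2 : Fin 3) ∈ s ∧ (0 : Fin 3) ∈ t)

instance (x y : Fin 8) : Decidable (Compat x y) := by unfold Compat; infer_instance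

/-- Local weight. -/
def wt (s t : Finset (Fin 3)) : ℤ := if s ∩ t = ∅ then (-1) ^ t.card else 0

theorem L_loc : ∀ x s, L x s ≠ 0 → Loc s := by decide +kernel

theorem hat_L : ∀ x s, Loc s → ∑ t, wt s t * L x t = L (x + 1) s := by decide +kernel

/-- The trace of `C` on block `b`. -/
def blk {n : ℕ} (C : Finset (Fin (n * 3))) (b : Fin n) : Finset (Fin 3) :=
  univ.filter fun j => finProdFinEquiv (b, j) ∈ C

/-- Subsets as families of blocks. -/
def blkEquiv (n : ℕ) : Finset (Fin (n * 3)) ≃ (Fin n → Finset (Fin 3)) where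
  toFun C b := blk C b
  invFun p := univ.filter fun x => (finProdFinEquiv.symm x).2 ∈ p (finProdFinEquiv.symm x).1
  left_inv C := by
    ext x
    simp only [blk, mem_filter, mem_univ, true_and]
    rw [Prod.mk.eta, Equiv.apply_symm_apply]
  right_inv p := by
    funext b
    ext j
    simp only [blk, mem_filter, mem_univ, true_and, Equiv.symm_apply_apply]

theorem card_blk {n : ℕ} (D : Finset (Fin (n * 3))) : D.card = ∑ b, (blk D b).card := by
  have h1 : D.card = ∑ x : Fin (n * 3), if x ∈ D then 1 else 0 := by simp
  rw [h1, ← finProdFinEquiv.sum_comp, Fintype.sum_prod_type]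
  refine sum_congr rfl fun b _ => ?_
  simp [blk]

theorem disj_blk {n : ℕ} (C D : Finset (Fin (n * 3))) :
    C ∩ D = ∅ ↔ ∀ b, blk C b ∩ blk D b = ∅ := by
  constructor
  · intro h b
    ext j
    have := Finset.ext_iff.1 h (finProdFinEquiv (b, j))
    simpa [blk] using this
  · intro h
    ext x
    obtain ⟨⟨b, j⟩, rfl⟩ := finProdFinEquiv.surjective x
    have := Finset.ext_iff.1 (h b) j
    simpa [blk] using this

theorem wt_prod {n : ℕ} (C D : Finset (Fin (n * 3))) :
    (if C ∩ D = ∅ then (-1 : ℤ) ^ D.card else 0) = ∏ b, wt (blk C b) (blk D b) := by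
  by_cases h : C ∩ D = ∅
  · rw [if_pos h, card_blk, ← prod_pow_eq_pow_sum]
    refine prod_congr rfl fun b _ => ?_
    rw [wt, if_pos ((disj_blk C D).1 h b)]
  · rw [if_neg h]
    rw [disj_blk] at h
    push Not at h
    obtain ⟨b, hb⟩ := h
    refine (prod_eq_zero (mem_univ b) ?_).symm
    rw [wt, if_neg]
    simpa [← nonempty_iff_ne_empty] using hb

/-- The product function attached to a word. -/
def Phi {n : ℕ} (w : Fin n → Fin 8) (C : Finset (Fin (n * 3))) : ℤ :=
  ∏ b, L (w b) (blk C b)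

theorem sum_Phi {n : ℕ} (w : Fin n → Fin 8) (C : Finset (Fin (n * 3))) :
    ∑ D, (if C ∩ D = ∅ then (-1 : ℤ) ^ D.card else 0) * Phi w D =
      ∏ b, ∑ t, wt (blk C b) t * L (w b) t := by
  rw [Fintype.prod_sum, ← (blkEquiv n).sum_comp]
  refine sum_congr rfl fun D _ => ?_
  rw [wt_prod, Phi, ← prod_mul_distrib]
  rfl

/-- Independence. -/
def Ind {K : ℕ} (C : Finset (Fin K)) : Prop := ∀ c ∈ C, ∀ d ∈ C, (c : ℕ) ≠ (d : ℕ) + 1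

theorem mem_blk {n : ℕ} (C : Finset (Fin (n * 3))) (b : Fin n) (j : Fin 3) :
    j ∈ blk C b ↔ finProdFinEquiv (b, j) ∈ C := by simp [blk]

theorem Ind.loc {n : ℕ} {C : Finset (Fin (n * 3))} (h : Ind C) (b : Fin n) : Loc (blk C b) := by
  constructor
  · rintro ⟨h0, h1⟩
    rw [mem_blk] at h0 h1
    have := h _ h1 _ h0
    simp [finProdFinEquiv] at this
    omega
  · rintro ⟨h0, h1⟩
    rw [mem_blk] at h0 h1
    have := h _ h1 _ h0
    simp [finProdFinEquiv] at this
    omega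

theorem Ind.adj {n : ℕ} {C : Finset (Fin (n * 3))} (h : Ind C) {b b' : Fin n}
    (hb : b'.val = b.val + 1) (h2 : 2 ∈ blk C b) (h0 : 0 ∈ blk C b') : False := by
  rw [mem_blk] at h0 h2
  have := h _ h0 _ h2
  simp [finProdFinEquiv] at this
  omega

theorem ind_of {n : ℕ} {C : Finset (Fin (n * 3))} (h : ∀ b, Loc (blk C b))
    (h' : ∀ b b' : Fin n, b'.val = b.val + 1 → ¬ (2 ∈ blk C b ∧ 0 ∈ blk C b')) : Ind C := by
  intro c hc d hd hcd
  obtain ⟨⟨b, j⟩, rfl⟩ := finProdFinEquiv.surjective c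
  obtain ⟨⟨b', j'⟩, rfl⟩ := finProdFinEquiv.surjective d
  rw [← mem_blk] at hc hd
  simp only [finProdFinEquiv_apply_val] at hcd
  have hbb : b.val = b'.val ∨ b.val = b'.val + 1 := by omega
  rcases hbb with hbb | hbb
  · obtain rfl : b = b' := Fin.ext hbb
    have := h b
    have hj : j.val = j'.val + 1 := by omega
    fin_cases j <;> fin_cases j' <;> simp at hj
    · exact this.1 ⟨hd, hc⟩
    · exact this.2 ⟨hd, hc⟩
  · have e1 : j = 0 := Fin.ext (by simp; omega)
    have e2 : j' = 2 := Fin.ext (by simp; omega)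
    subst e1 e2
    exact h' b' b hbb ⟨hd, hc⟩

theorem Phi_ind {n : ℕ} {w : Fin n → Fin 8}
    (hv : ∀ b b' : Fin n, b'.val = b.val + 1 → Compat (w b) (w b'))
    {C : Finset (Fin (n * 3))} (hC : Phi w C ≠ 0) : Ind C := by
  have h : ∀ b, L (w b) (blk C b) ≠ 0 := fun b => by
    have := prod_ne_zero_iff.1 hC b (mem_univ b)
    exact this
  exact ind_of (fun b => L_loc _ _ (h b)) fun b b' hb => hv b b' hb _ _ (h b) (h b')

theorem prod_eq {n : ℕ} (x y : Fin n → ℤ)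
    (h : ∀ b, x b = y b ∨ ((∃ c, x c = 0) ∧ (∃ c, y c = 0))) : ∏ b, x b = ∏ b, y b := by
  by_cases h' : (∃ c, x c = 0) ∧ (∃ c, y c = 0)
  · obtain ⟨⟨c, hc⟩, ⟨d, hd⟩⟩ := h'
    rw [prod_eq_zero (mem_univ c) hc, prod_eq_zero (mem_univ d) hd]
  · exact prod_congr rfl fun b _ => (h b).resolve_right h'

theorem loc67 : ∀ s, Loc s → L 7 s ≠ L 4 s → 2 ∈ s := by decide +kernel
theorem loc30 : ∀ s, Loc s → L 3 s ≠ L 0 s → 0 ∈ s := by decide +kernel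
theorem L_zero_of_not0 : ∀ s, (0 : Fin 3) ∉ s → L 7 s = 0 ∧ L 4 s = 0 := by decide +kernel
theorem L_zero_of_not2 : ∀ s, (2 : Fin 3) ∉ s → L 3 s = 0 ∧ L 0 s = 0 := by decide +kernel

/-- `w'` is a valid successor of `w`. -/
def Succ {n : ℕ} (w w' : Fin n → Fin 8) : Prop :=
  (∀ b b' : Fin n, b'.val = b.val + 1 → Compat (w b) (w b')) ∧
  ∀ b, w' b = w b + 1 ∨
    (w b = 6 ∧ w' b = 4 ∧ ∃ b' : Fin n, b'.val = b.val + 1 ∧ (w b' = 6 ∨ w b' = 3) ∧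
      (w' b' = 4 ∨ w' b' = 7)) ∨
    (w b = 2 ∧ w' b = 0 ∧ ∃ b' : Fin n, b.val = b'.val + 1 ∧ (w b' = 2 ∨ w b' = 7) ∧
      (w' b' = 0 ∨ w' b' = 3))

theorem step_Phi {n : ℕ} {w w' : Fin n → Fin 8} (h : Succ w w')
    {C : Finset (Fin (n * 3))} (hC : Ind C) :
    ∑ D, (if C ∩ D = ∅ then (-1 : ℤ) ^ D.card else 0) * Phi w D = Phi w' C := by
  rw [sum_Phi, Phi]
  apply prod_eq
  intro b
  simp only [hat_L _ _ (hC.loc _)]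
  rcases h.2 b with h1 | ⟨h1, h2, b', hb, h3, h4⟩ | ⟨h1, h2, b', hb, h3, h4⟩
  · left; rw [h1]
  · by_cases hne : L 7 (blk C b) = L 4 (blk C b)
    · left; rw [h1, h2]; exact hne
    · right
      have h0 : 0 ∉ blk C b' := fun h0 => hC.adj hb (loc67 _ (hC.loc b) hne) h0
      have hz := L_zero_of_not0 _ h0
      refine ⟨⟨b', ?_⟩, ⟨b', ?_⟩⟩
      · rcases h3 with h3 | h3 <;> rw [h3]
        exacts [hz.1, hz.2]
      · rcases h4 with h4 | h4 <;> rw [h4]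
        exacts [hz.2, hz.1]
  · by_cases hne : L 3 (blk C b) = L 0 (blk C b)
    · left; rw [h1, h2]; exact hne
    · right
      have h0 : 2 ∉ blk C b' := fun h0 => hC.adj hb h0 (loc30 _ (hC.loc b) hne)
      have hz := L_zero_of_not2 _ h0
      refine ⟨⟨b', ?_⟩, ⟨b', ?_⟩⟩
      · rcases h3 with h3 | h3 <;> rw [h3]
        exacts [hz.1, hz.2]
      · rcases h4 with h4 | h4 <;> rw [h4]
        exacts [hz.2, hz.1]

/-- The vector attached to a word. -/
noncomputable def vec {n : ℕ} (w : Fin n → Fin 8) : PathIndep (n * 3) → ℂ :=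
  fun C => Complex.I ^ C.1.card * (Phi w C.1 : ℂ)

theorem step_vec {n : ℕ} {w w' : Fin n → Fin 8} (h : Succ w w') :
    (Omat (n * 3)).mulVec (vec w) = vec w' := by
  funext C
  have hs := step_Phi h (C := C.1) C.2
  rw [vec, ← hs, Matrix.mulVec, dotProduct]
  have hsub : ∑ D, (if C.1 ∩ D = ∅ then (-1 : ℤ) ^ D.card else 0) * Phi w D =
      ∑ D : PathIndep (n * 3), (if C.1 ∩ D.1 = ∅ then (-1 : ℤ) ^ D.1.card else 0) * Phi w D.1 := by
    rw [← Finset.sum_subtype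
      (s := univ.filter fun D : Finset (Fin (n * 3)) => ∀ c ∈ D, ∀ d ∈ D, (c : ℕ) ≠ (d : ℕ) + 1)
      (by simp) (fun D => (if C.1 ∩ D = ∅ then (-1 : ℤ) ^ D.card else 0) * Phi w D)]
    rw [sum_filter_of_ne]
    intro D _ hD
    exact Phi_ind h.1 (right_ne_zero_of_mul hD)
  rw [hsub]
  push_cast
  rw [mul_sum]
  refine sum_congr rfl fun D _ => ?_
  simp only [Omat, vec]
  split_ifs
  · rw [pow_add, ← Complex.I_mul_I, mul_pow]; ring
  · simp

/-- Words made of a left part, a middle letter and a right part. -/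
def S (n m : ℕ) (x y z : Fin 8) : Fin n → Fin 8 := fun b =>
  if b.val < m then x else if b.val = m then y else z

theorem compat_S {n m : ℕ} {x y z : Fin 8} (h1 : Compat x x) (h2 : Compat x y)
    (h3 : Compat y z) (h4 : Compat z z) (b b' : Fin n) (hb : b'.val = b.val + 1) :
    Compat (S n m x y z b) (S n m x y z b') := by
  unfold S
  rcases lt_trichotomy (b.val + 1) m with h | h | h
  · rw [if_pos (by omega), if_pos (by omega)]; exact h1
  · rw [if_pos (by omega), if_neg (by omega), if_pos (by omega)]; exact h2
  · rw [if_neg (show ¬ b.val < m by omega), if_neg (show ¬ b'.val < m by omega),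
      if_neg (show ¬ b'.val = m by omega)]
    split_ifs
    exacts [h3, h4]

theorem succ_plain {n m : ℕ} {x y z : Fin 8} (h1 : Compat x x) (h2 : Compat x y)
    (h3 : Compat y z) (h4 : Compat z z) :
    Succ (S n m x y z) (S n m (x + 1) (y + 1) (z + 1)) := by
  refine ⟨compat_S h1 h2 h3 h4, fun b => Or.inl ?_⟩
  unfold S
  split_ifs <;> rfl

/-- The `2`-tail collapses to `0`. -/
theorem succ_tail {n m : ℕ} {x y : Fin 8} (h1 : Compat x x) (h2 : Compat x y)
    (hy : y = 2 ∨ y = 7) :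
    Succ (S n m x y 2) (S n m (x + 1) (y + 1) 0) := by
  refine ⟨compat_S h1 h2 (by rcases hy with rfl | rfl <;> decide +kernel) (by decide +kernel),
    fun b => ?_⟩
  rcases lt_trichotomy b.val m with h | h | h
  · left; simp [S, h]
  · left; simp [S, h]
  · right; right
    refine ⟨by simp [S, h.not_gt, h.ne'], by simp [S, h.not_gt, h.ne'],
      ⟨b.val - 1, by omega⟩, by simp; omega, ?_, ?_⟩
    · unfold S
      rw [if_neg (by simp; omega)]
      split_ifs
      · exact hy
      · exact Or.inl rfl
    · unfold S
      rw [if_neg (by simp; omega)]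
      split_ifs
      · rcases hy with rfl | rfl
        · right; rfl
        · left; rfl
      · exact Or.inl rfl

theorem succ_P1 {n m : ℕ} (hm : m < n) : Succ (S n m 6 3 0) (S n (m + 1) 4 1 1) := by
  refine ⟨compat_S (by decide +kernel) (by decide +kernel) (by decide +kernel)
    (by decide +kernel), fun b => ?_⟩
  rcases lt_trichotomy b.val m with h | h | h
  · right; left
    refine ⟨by simp [S, h], by simp [S]; omega, ⟨b.val + 1, by omega⟩, rfl, ?_, ?_⟩
    · unfold S
      split_ifs
      · exact Or.inl rfl
      · exact Or.inr rfl
      · simp at *; omega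
    · left; simp [S]; omega
  · left; simp [S, h]
  · left
    unfold S
    rw [if_neg (show ¬ b.val < m + 1 by omega), if_neg (show ¬ b.val < m by omega),
      if_neg (show ¬ b.val = m by omega)]
    split_ifs <;> rfl

theorem succ_Q3 {n p : ℕ} {y z : Fin 8} (hp : p < n)
    (h : p + 1 = n ∨ (y = 1 ∧ z = 1)) (h2 : Compat 6 y)
    (h3 : Compat y z) (h4 : Compat z z) :
    Succ (S n (p + 1) 6 y z) (S n p 4 7 2) := by
  refine ⟨compat_S (by decide +kernel) h2 h3 h4, fun b => ?_⟩
  rcases lt_trichotomy b.val p with hb | hb | hb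
  · right; left
    refine ⟨by simp [S]; omega, by simp [S, hb], ⟨b.val + 1, by omega⟩, rfl, ?_, ?_⟩
    · left; simp [S]; omega
    · unfold S
      split_ifs
      · exact Or.inl rfl
      · exact Or.inr rfl
      · simp at *; omega
  · left; simp [S, hb]
  · left
    obtain ⟨rfl, rfl⟩ : y = 1 ∧ z = 1 := h.resolve_left (by omega)
    unfold S
    rw [if_neg (by omega), if_neg (by omega), if_neg (by omega)]
    split_ifs <;> rfl

/-- The orbit. -/
noncomputable def V (n j : ℕ) : PathIndep (n * 3) → ℂ :=
  (Omat (n * 3)).mulVec^[j] (vec (S n 0 4 7 2))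

theorem V_succ (n j : ℕ) : (Omat (n * 3)).mulVec (V n j) = V n (j + 1) := by
  rw [V, V, Function.iterate_succ_apply']

theorem V_step {n j : ℕ} {w w' : Fin n → Fin 8} (h : V n j = vec w) (hs : Succ w w') :
    V n (j + 1) = vec w' := by
  rw [← V_succ, h, step_vec hs]

theorem S_zero (n : ℕ) (x x' y z : Fin 8) : S n 0 x y z = S n 0 x' y z := by
  funext b; simp [S]

theorem V_one (n : ℕ) : V n 1 = vec (S n 0 5 0 0) :=
  V_step (j := 0) rfl (succ_tail (by decide +kernel) (by decide +kernel) (Or.inr rfl))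

theorem V_two (n : ℕ) : V n 2 = vec (S n 0 4 1 1) := by
  rw [S_zero n 4 6]
  exact V_step (V_one n) (succ_plain (by decide +kernel) (by decide +kernel) (by decide +kernel)
    (by decide +kernel))

theorem V_P3_of {n m : ℕ} (h : V n (3 * m + 2) = vec (S n m 4 1 1)) :
    V n (3 * m + 3) = vec (S n m 5 2 2) :=
  V_step h (succ_plain (by decide +kernel) (by decide +kernel) (by decide +kernel)
    (by decide +kernel))

theorem V_P1_of {n m : ℕ} (h : V n (3 * m + 2) = vec (S n m 4 1 1)) :
    V n (3 * m + 4) = vec (S n m 6 3 0) :=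
  V_step (V_P3_of h) (succ_tail (by decide +kernel) (by decide +kernel) (Or.inl rfl))

theorem V_P2 (n m : ℕ) (hm : m ≤ n) : V n (3 * m + 2) = vec (S n m 4 1 1) := by
  induction m with
  | zero => exact V_two n
  | succ m ih => exact V_step (V_P1_of (ih (by omega))) (succ_P1 (by omega))

theorem V_Q2_of {n p j : ℕ} (h : V n j = vec (S n p 4 7 2)) :
    V n (j + 1) = vec (S n p 5 0 0) :=
  V_step h (succ_tail (by decide +kernel) (by decide +kernel) (Or.inr rfl))

theorem V_Q3_of {n p j : ℕ} (h : V n j = vec (S n p 4 7 2)) :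
    V n (j + 2) = vec (S n p 6 1 1) :=
  V_step (V_Q2_of h) (succ_plain (by decide +kernel) (by decide +kernel) (by decide +kernel)
    (by decide +kernel))

theorem V_Q1 (n q p : ℕ) (h : p + q + 1 = n) :
    V n (3 * n + 5 + 3 * q) = vec (S n p 4 7 2) := by
  induction q generalizing p with
  | zero =>
    obtain rfl : n = p + 1 := by omega
    exact V_step (V_P1_of (V_P2 (p + 1) (p + 1) le_rfl))
      (succ_Q3 (by omega) (Or.inl rfl) (by decide +kernel) (by decide +kernel) (by decide +kernel))
  | succ q ih =>
    exact V_step (V_Q3_of (ih (p + 1) (by omega)))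
      (succ_Q3 (by omega) (Or.inr ⟨rfl, rfl⟩) (by decide +kernel) (by decide +kernel)
        (by decide +kernel))

theorem V_period (n : ℕ) (hn : 1 ≤ n) : V n (6 * n + 2) = V n 0 := by
  have := V_Q1 n (n - 1) 0 (by omega)
  rw [show 3 * n + 5 + 3 * (n - 1) = 6 * n + 2 by omega] at this
  rw [this]; rfl

theorem eig {ι : Type*} [Fintype ι] (A : Matrix ι ι ℂ) (W : ℕ → ι → ℂ) (N : ℕ) (ζ : ℂ)
    (hW : ∀ j, A.mulVec (W j) = W (j + 1)) (hN : W N = W 0) (hζ0 : ζ ≠ 0) (hζ : ζ ^ N = 1)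
    (hne : ∑ j ∈ range N, ζ⁻¹ ^ j • W j ≠ 0) : IsEigenvalue A ζ := by
  refine ⟨_, hne, ?_⟩
  have h1 : A.mulVec (∑ j ∈ range N, ζ⁻¹ ^ j • W j) = ∑ j ∈ range N, ζ⁻¹ ^ j • W (j + 1) := by
    rw [← Matrix.mulVecLin_apply, map_sum]
    refine sum_congr rfl fun j _ => ?_
    rw [map_smul, Matrix.mulVecLin_apply, hW]
  have h2 : ∑ j ∈ range N, ζ⁻¹ ^ j • W j = ∑ j ∈ range N, ζ⁻¹ ^ (j + 1) • W (j + 1) := by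
    have a := sum_range_succ (fun j => ζ⁻¹ ^ j • W j) N
    rw [sum_range_succ' (fun j => ζ⁻¹ ^ j • W j) N] at a
    simp only [inv_pow, hζ, hN, inv_one, pow_zero] at a
    simpa using (add_right_cancel a).symm
  rw [h1, h2, smul_sum]
  refine sum_congr rfl fun j _ => ?_
  rw [smul_smul, pow_succ', ← mul_assoc, mul_inv_cancel₀ hζ0, one_mul]

/-- The set `{1, 3}`. -/
def C13 (n : ℕ) (hn : 1 ≤ n) : PathIndep (n * 3) :=
  ⟨{⟨0, by omega⟩, ⟨2, by omega⟩}, by simp⟩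

theorem blk_C13_zero (n : ℕ) (hn : 1 ≤ n) : blk (C13 n hn).1 ⟨0, hn⟩ = {0, 2} := by
  ext j
  fin_cases j <;> simp [blk, C13, finProdFinEquiv]

theorem blk_C13_pos (n : ℕ) (hn : 1 ≤ n) (b : Fin n) (hb : 0 < b.val) :
    blk (C13 n hn).1 b = ∅ := by
  ext j
  simp only [blk, C13, finProdFinEquiv, mem_filter, mem_univ, true_and, mem_insert, mem_singleton,
    notMem_empty, iff_false, Fin.ext_iff, Equiv.coe_fn_mk]
  omega

theorem vec_C13_zero {n : ℕ} (hn : 1 ≤ n) (w : Fin n → Fin 8) (h : L (w ⟨0, hn⟩) {0, 2} = 0) :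
    vec w (C13 n hn) = 0 := by
  have : Phi w (C13 n hn).1 = 0 :=
    prod_eq_zero (mem_univ ⟨0, hn⟩) (by rw [blk_C13_zero]; exact h)
  simp [vec, this]

theorem vec_C13_zero' {n : ℕ} (hn : 2 ≤ n) (w : Fin n → Fin 8) (h : L (w ⟨1, hn⟩) ∅ = 0) :
    vec w (C13 n (by omega)) = 0 := by
  have : Phi w (C13 n (by omega)).1 = 0 :=
    prod_eq_zero (mem_univ ⟨1, hn⟩) (by rw [blk_C13_pos _ _ _ (by simp)]; exact h)
  simp [vec, this]

theorem V_C13_zero {n : ℕ} (hn : 1 ≤ n) : V n 0 (C13 n hn) ≠ 0 := by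
  have : Phi (S n 0 4 7 2) (C13 n hn).1 ≠ 0 := by
    refine prod_ne_zero_iff.2 fun b _ => ?_
    rcases Nat.eq_zero_or_pos b.val with h | h
    · obtain rfl : b = ⟨0, hn⟩ := Fin.ext h
      rw [blk_C13_zero]; simp [S]; decide +kernel
    · rw [blk_C13_pos _ _ _ h]
      simp [S, h.ne']; decide +kernel
  change vec (S n 0 4 7 2) _ ≠ 0
  simp [vec, this]

theorem V_C13_pos {n : ℕ} (hn : 2 ≤ n) (j : ℕ) (h1 : 1 ≤ j) (h2 : j < 6 * n + 2) :
    V n j (C13 n (by omega)) = 0 := by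
  have key : ∀ m x y z, L x {0, 2} = 0 → L y {0, 2} = 0 →
      vec (S n m x y z) (C13 n (by omega)) = 0 := by
    intro m x y z hx hy
    apply vec_C13_zero
    rcases Nat.eq_zero_or_pos m with h | h
    · simp [S, h, hy]
    · simp [S, h, hx]
  rcases Nat.lt_or_ge j 2 with h | h
  · obtain rfl : j = 1 := by omega
    rw [V_one]; exact key _ _ _ _ (by decide +kernel) (by decide +kernel)
  rcases Nat.lt_or_ge j (3 * n + 5) with h' | h'
  · obtain ⟨m, hm, hj⟩ : ∃ m, m ≤ n ∧ (j = 3 * m + 2 ∨ j = 3 * m + 3 ∨ j = 3 * m + 4) :=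
      ⟨(j - 2) / 3, by omega, by omega⟩
    rcases hj with rfl | rfl | rfl
    · rw [V_P2 n m hm]; exact key _ _ _ _ (by decide +kernel) (by decide +kernel)
    · rw [V_P3_of (V_P2 n m hm)]; exact key _ _ _ _ (by decide +kernel) (by decide +kernel)
    · rw [V_P1_of (V_P2 n m hm)]
      rcases Nat.eq_zero_or_pos m with h0 | h0
      · subst h0
        apply vec_C13_zero' hn
        simp [S]; decide +kernel
      · apply vec_C13_zero
        simp [S, h0]; decide +kernel
  · obtain ⟨q, hq, hj⟩ : ∃ q, q + 1 ≤ n ∧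
        (j = 3 * n + 5 + 3 * q ∨ j = 3 * n + 5 + 3 * q + 1 ∨ j = 3 * n + 5 + 3 * q + 2) :=
      ⟨(j - (3 * n + 5)) / 3, by omega, by omega⟩
    obtain ⟨p, hp⟩ : ∃ p, p + q + 1 = n := ⟨n - q - 1, by omega⟩
    have hV := V_Q1 n q p hp
    rcases hj with rfl | rfl | rfl
    · rw [hV]
      apply vec_C13_zero
      have : 0 < p := by omega
      simp [S, this]; decide +kernel
    · rw [V_Q2_of hV]; exact key _ _ _ _ (by decide +kernel) (by decide +kernel)
    · rw [V_Q3_of hV]; exact key _ _ _ _ (by decide +kernel) (by decide +kernel)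

theorem main_big (n : ℕ) (hn : 2 ≤ n) (ζ : ℂ) (hζ : ζ ^ (6 * n + 2) = 1) :
    IsEigenvalue (Omat (n * 3)) ζ := by
  have h0 : ζ ≠ 0 := by rintro rfl; simp at hζ
  refine eig _ (V n) (6 * n + 2) ζ (V_succ n) (V_period n (by omega)) h0 hζ fun h => ?_
  have h' := congrFun h (C13 n (by omega))
  rw [Finset.sum_apply, sum_eq_single 0] at h'
  · simp at h'
    exact V_C13_zero _ h'
  · intro j hj hj0
    rw [Pi.smul_apply, V_C13_pos hn j (by omega) (mem_range.1 hj), smul_zero]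
  · simp

/-- The set `{1}` for `K = 3`. -/
def C1 : PathIndep (1 * 3) := ⟨{0}, by decide +kernel⟩

theorem main_small (ζ : ℂ) (hζ : ζ ^ 8 = 1) (hm : ζ ≠ -1) (hi : ζ ≠ Complex.I)
    (hmi : ζ ≠ -Complex.I) : IsEigenvalue (Omat (1 * 3)) ζ := by
  have h0 : ζ ≠ 0 := by rintro rfl; simp at hζ
  refine eig _ (V 1) 8 ζ (V_succ 1) (V_period 1 le_rfl) h0 hζ fun h => ?_
  have e0 : V 1 0 = vec (fun _ => 7) := congrArg vec (by decide +kernel)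
  have e1 : V 1 1 = vec (fun _ => 0) := (V_one 1).trans (congrArg vec (by decide +kernel))
  have e2 : V 1 2 = vec (fun _ => 1) := (V_two 1).trans (congrArg vec (by decide +kernel))
  have e3 : V 1 3 = vec (fun _ => 2) :=
    (V_P3_of (V_P2 1 0 (by omega))).trans (congrArg vec (by decide +kernel))
  have e4 : V 1 4 = vec (fun _ => 3) :=
    (V_P1_of (V_P2 1 0 (by omega))).trans (congrArg vec (by decide +kernel))
  have e5 : V 1 5 = vec (fun _ => 4) :=
    (V_P2 1 1 (by omega)).trans (congrArg vec (by decide +kernel))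
  have e6 : V 1 6 = vec (fun _ => 5) :=
    (V_P3_of (V_P2 1 1 (by omega))).trans (congrArg vec (by decide +kernel))
  have e7 : V 1 7 = vec (fun _ => 6) :=
    (V_P1_of (V_P2 1 1 (by omega))).trans (congrArg vec (by decide +kernel))
  have p (k : Fin 8) (C : PathIndep (1 * 3)) :
      vec (fun _ : Fin 1 => k) C = Complex.I ^ C.1.card * (L k (blk C.1 0) : ℂ) := by
    simp [vec, Phi]
  have b1 : blk C1.1 (0 : Fin 1) = {0} := by decide +kernel
  have b13 : blk (C13 1 le_rfl).1 (0 : Fin 1) = {0, 2} := by decide +kernel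
  have c1 : C1.1.card = 1 := by decide +kernel
  have c13 : (C13 1 le_rfl).1.card = 2 := by decide +kernel
  have n1 : ({0} : Finset (Fin 3)) ≠ {1} := by decide
  have n2 : ({0} : Finset (Fin 3)) ≠ {2} := by decide
  have n3 : ({0} : Finset (Fin 3)) ≠ {0, 2} := by decide
  have n4 : ({0, 2} : Finset (Fin 3)) ≠ {0} := by decide
  have n5 : ({0, 2} : Finset (Fin 3)) ≠ {1} := by decide
  have n6 : ({0, 2} : Finset (Fin 3)) ≠ {2} := by decide
  have n7 : ({0, 2} : Finset (Fin 3)) ≠ ∅ := by decide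
  have h13 := congrFun h (C13 1 le_rfl)
  have h1 := congrFun h C1
  simp only [sum_range_succ, range_zero, sum_empty, zero_add, e0, e1, e2, e3, e4, e5, e6, e7,
    Pi.add_apply, Pi.smul_apply, p, b1, b13, c1, c13, Pi.zero_apply, L, n1, n2, n3, n4, n5, n6,
    n7] at h13 h1
  simp [Complex.I_sq] at h13 h1
  have h4 : ζ ^ 4 = 1 := by
    have : (ζ ^ 4)⁻¹ = 1 := by linear_combination -h13
    exact inv_eq_one.1 this
  have hz1 : ζ = 1 := by
    have : (ζ - 1) * ((ζ + 1) * ((ζ - Complex.I) * (ζ + Complex.I))) = 0 := by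
      linear_combination h4 + (1 - ζ ^ 2) * Complex.I_sq
    rcases mul_eq_zero.1 this with h | h
    · exact sub_eq_zero.1 h
    rcases mul_eq_zero.1 h with h | h
    · exact absurd (eq_neg_of_add_eq_zero_left h) hm
    rcases mul_eq_zero.1 h with h | h
    · exact absurd (sub_eq_zero.1 h) hi
    · exact absurd (eq_neg_of_add_eq_zero_left h) hmi
  subst hz1
  norm_num at h1
  have : (4 : ℂ) * Complex.I = 0 := by linear_combination -h1
  simp at this

end OmatAux

/-- For `K ≡ 0 (mod 3)`, every `(2K+2)`-th root of unity other than `-1` (and,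
in case `K` is odd, other than `i` and `-i`) is an eigenvalue of `𝕆_K`. -/
theorem Omat_eigenvalues_K0 (K : ℕ) (hK : 1 ≤ K) (hK3 : K % 3 = 0)
    (ζ : ℂ) (hζ : ζ ^ (2 * K + 2) = 1) (hζ1 : ζ ≠ -1)
    (hζi : Odd K → ζ ≠ Complex.I ∧ ζ ≠ -Complex.I) :
    IsEigenvalue (Omat K) ζ := by
  obtain ⟨n, rfl⟩ : ∃ n, K = n * 3 := ⟨K / 3, by omega⟩
  have hζ' : ζ ^ (6 * n + 2) = 1 := by
    rw [← hζ]; congr 1; ring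
  rcases Nat.lt_or_ge n 2 with h | h
  · obtain rfl : n = 1 := by omega
    obtain ⟨h1, h2⟩ := hζi (by decide)
    exact OmatAux.main_small ζ hζ' hζ1 h1 h2
  · exact OmatAux.main_big n h ζ hζ'
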